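/- Suppose the flow Φ of the C¹ vector field X on ℝⁿ satisfies condition (UB), satisfies inf_{x∈ℝⁿ} |X(x)| > 0 (in particular it has no rest points), and has the Lipschitz inverse shadowing property with respect to the class 𝒯ₛ of smooth methods. Then there exists a constant L₁ > 0 such that for every point p ∈ ℝⁿ, every sequence (z_k)_{k∈ℤ} in ℝⁿ with |z_k| ≤ 1 for all k, and every natural number N, there exist real numbers s_k (for k ∈ [−N, N−1]) and vectors x_k ∈ ℝⁿ (for k ∈ [−N, N]) with |x_k| ≤ L₁ for all k, satisfying x_{k+1} = A_k x_k + s_k X(p_{k+1}) + z_{k+1} for all k ∈ [−N, N−1], where p_k := Φ(k, p) and A_k := D(Φ(1,·))(p_k) is the derivative of the time-one map of Φ at p_k. -/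

import Mathlib

open Set

noncomputable section

/-- Euclidean space ℝⁿ. -/
abbrev Euc (n : ℕ) := EuclideanSpace ℝ (Fin n)

/-- `Φ` is the flow of the vector field `X` on ℝⁿ: `Φ 0 x = x` and
`∂Φ/∂t (t, x) = X (Φ t x)`. -/
def IsFlow {n : ℕ} (X : Euc n → Euc n) (Φ : ℝ → Euc n → Euc n) : Prop :=
  (∀ x, Φ 0 x = x) ∧ ∀ (t : ℝ) (x : Euc n), HasDerivAt (fun s => Φ s x) (X (Φ t x)) t

/-- `Ψ` is a `d`-method for the flow `Φ`. -/
def IsMethod {n : ℕ} (Φ Ψ : ℝ → Euc n → Euc n) (d : ℝ) : Prop :=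
  (∀ x, Ψ 0 x = x) ∧
  ∀ (t : ℝ), ∀ s ∈ Icc (-1 : ℝ) 1, ∀ x, ‖Ψ (t + s) x - Φ s (Ψ t x)‖ < d

/-- The class `Tclₛ` of smooth methods. -/
def SmoothMethod {n : ℕ} (Ψ : ℝ → Euc n → Euc n) : Prop :=
  ContDiff ℝ (⊤ : ℕ∞) (fun q : ℝ × Euc n => Ψ q.1 q.2)

/-- `α ∈ Rep(δ)`: an increasing homeomorphism of ℝ fixing 0 with
`|(α t - α s)/(t - s) - 1| ≤ δ` for `t ≠ s`. -/
def MemRep (α : ℝ → ℝ) (δ : ℝ) : Prop :=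
  StrictMono α ∧ Function.Bijective α ∧ α 0 = 0 ∧
    ∀ t s : ℝ, t ≠ s → |(α t - α s) / (t - s) - 1| ≤ δ

/-- The Lipschitz inverse shadowing property of `Φ` with respect to a class `Tcl` of methods. -/
def LISP {n : ℕ} (Φ : ℝ → Euc n → Euc n) (Tcl : (ℝ → Euc n → Euc n) → Prop) : Prop :=
  ∀ p : Euc n, ∃ L > (0 : ℝ), ∃ d₀ > (0 : ℝ), ∀ d : ℝ, 0 < d → d ≤ d₀ →
    ∀ Ψ : ℝ → Euc n → Euc n, Tcl Ψ → IsMethod Φ Ψ d →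
      ∃ (phat : Euc n) (α : ℝ → ℝ), MemRep α (L * d) ∧
        ∀ t : ℝ, ‖Φ t p - Ψ (α t) phat‖ < L * d

/-- Condition (UB): bounded derivatives in initial data on unit times, bounded vector field,
and a uniform first-order Taylor remainder for the flow. -/
def UB {n : ℕ} (X : Euc n → Euc n) (Φ : ℝ → Euc n → Euc n) : Prop :=
  (∃ Q₁ : ℝ, ∀ x : Euc n, ∀ s ∈ Icc (-1 : ℝ) 1, ‖fderiv ℝ (Φ s) x‖ ≤ Q₁) ∧
  (∃ Q₂ : ℝ, ∀ x : Euc n, ‖X x‖ ≤ Q₂) ∧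
  (∃ g₁ : ℝ → ℝ, MonotoneOn g₁ (Ici 0) ∧
    Filter.Tendsto (fun h => g₁ h / h) (nhdsWithin 0 (Ioi 0)) (nhds 0) ∧
    ∀ (x : Euc n) (t h₁ : ℝ) (h₂ : Euc n), |h₁| ≤ 1 → ‖h₂‖ ≤ 1 →
      ‖Φ (t + h₁) (x + h₂) - Φ t x - h₁ • X (Φ t x) - fderiv ℝ (Φ t) x h₂‖ ≤
        g₁ (|h₁| + ‖h₂‖))

namespace IsFlow

variable {n : ℕ} {X : Euc n → Euc n} {Φ : ℝ → Euc n → Euc n}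

/-- A flow moves points at most at the supremal speed of its vector field. -/
lemma norm_sub_le (hΦ : IsFlow X Φ) {Q : ℝ} (hQ : ∀ x, ‖X x‖ ≤ Q) (t s : ℝ) (x : Euc n) :
    ‖Φ t x - Φ s x‖ ≤ Q * |t - s| :=
  convex_univ.norm_image_sub_le_of_norm_hasDerivWithin_le
    (fun u _ => (hΦ.2 u x).hasDerivWithinAt) (fun _ _ => hQ _) (mem_univ s) (mem_univ t)

/-- Two bounded-speed integral curves of a `C¹` vector field which meet at time `0` agree. -/
lemma eq_of_eq_zero (hX : ContDiff ℝ 1 X) {Q : ℝ} (hQ : ∀ x, ‖X x‖ ≤ Q) {f g : ℝ → Euc n}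
    (hf : ∀ t, HasDerivAt f (X (f t)) t) (hg : ∀ t, HasDerivAt g (X (g t)) t) (h0 : f 0 = g 0) :
    f = g := by
  have key : ∀ h : ℝ → Euc n, (∀ t, HasDerivAt h (X (h t)) t) → ∀ T : ℝ, ∀ t ∈ Ioo (-T) T,
      h t ∈ Metric.closedBall (h 0) (Q * T) := by
    intro h hh T t ht
    have h1 := convex_univ.norm_image_sub_le_of_norm_hasDerivWithin_le
      (fun u _ => (hh u).hasDerivWithinAt) (fun _ _ => hQ _) (mem_univ (0 : ℝ)) (mem_univ t)
    have hQ0 : 0 ≤ Q := (norm_nonneg _).trans (hQ 0)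
    rw [mem_closedBall_iff_norm]
    refine h1.trans (mul_le_mul_of_nonneg_left ?_ hQ0)
    rw [sub_zero, Real.norm_eq_abs]
    exact (abs_lt.2 ht).le
  ext1 t
  set T := |t| + 1
  set B := Metric.closedBall (f 0) (Q * T)
  have hcompact : IsCompact B := isCompact_closedBall _ _
  obtain ⟨C, hC⟩ := hcompact.exists_bound_of_continuousOn
    (hX.continuous_fderiv one_ne_zero).continuousOn
  have hlip : LipschitzOnWith C.toNNReal X B := by
    refine (convex_closedBall _ _).lipschitzOnWith_of_nnnorm_fderiv_le
      (fun x _ => (hX.differentiable one_ne_zero) x) fun x hx => ?_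
    rw [← NNReal.coe_le_coe, coe_nnnorm]
    exact (hC x hx).trans (Real.le_coe_toNNReal C)
  have ht : t ∈ Ioo (-T) T := abs_lt.1 (lt_add_one |t|)
  have h00 : (0 : ℝ) ∈ Ioo (-T) T := by
    have : 0 < T := by positivity
    exact ⟨by linarith, this⟩
  refine ODE_solution_unique_of_mem_Ioo (v := fun _ => X) (s := fun _ => B) (K := C.toNNReal)
    (fun _ _ => hlip) h00 (fun u hu => ⟨hf u, key f hf T u hu⟩)
    (fun u hu => ⟨hg u, ?_⟩) h0 ht
  have := key g hg T u hu
  rwa [← h0] at this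

/-- The group property of the flow of a bounded `C¹` vector field. -/
lemma map_add (hΦ : IsFlow X Φ) (hX : ContDiff ℝ 1 X) {Q : ℝ} (hQ : ∀ x, ‖X x‖ ≤ Q)
    (t s : ℝ) (x : Euc n) : Φ (t + s) x = Φ t (Φ s x) := by
  have := eq_of_eq_zero hX hQ (f := fun u => Φ (u + s) x) (g := fun u => Φ u (Φ s x))
    (fun u => (hΦ.2 (u + s) x).comp_add_const u s) (fun u => hΦ.2 u _)
    (by simp only [zero_add, hΦ.1])
  exact congrFun this t

end IsFlow

/-- The properties of a flow satisfying (UB) on which the main argument relies: bounded speed `Q`,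
differentiability of the time-`t` maps, derivatives growing at most linearly in time and
equicontinuous uniformly in time, and a uniform first-order Taylor expansion. -/
structure TameFlow {n : ℕ} (X : Euc n → Euc n) (Φ : ℝ → Euc n → Euc n) (Q C : ℝ) : Prop where
  map_zero : ∀ x, Φ 0 x = x
  map_add : ∀ t s x, Φ (t + s) x = Φ t (Φ s x)
  hasDerivAt : ∀ t x, HasDerivAt (fun s => Φ s x) (X (Φ t x)) t
  norm_sub_le : ∀ t s x, ‖Φ t x - Φ s x‖ ≤ Q * |t - s|
  hasFDerivAt : ∀ t x, HasFDerivAt (Φ t) (fderiv ℝ (Φ t) x) x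
  norm_fderiv_le : ∀ t x, ‖fderiv ℝ (Φ t) x‖ ≤ C * (1 + |t|)
  norm_fderiv_sub_le : ∀ δ > (0 : ℝ), ∃ r > (0 : ℝ), ∀ t x y, ‖y - x‖ ≤ r →
    ‖fderiv ℝ (Φ t) y - fderiv ℝ (Φ t) x‖ ≤ δ
  taylor : ∀ δ > (0 : ℝ), ∃ r > (0 : ℝ), ∀ (t : ℝ) (x : Euc n) (h₁ : ℝ) (h₂ : Euc n),
    |h₁| + ‖h₂‖ ≤ r →
    ‖Φ (t + h₁) (x + h₂) - Φ t x - h₁ • X (Φ t x) - fderiv ℝ (Φ t) x h₂‖ ≤ δ * (|h₁| + ‖h₂‖)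

lemma exists_tameFlow {n : ℕ} {X : Euc n → Euc n} {Φ : ℝ → Euc n → Euc n}
    (hX : ContDiff ℝ 1 X) (hΦ : IsFlow X Φ) (hUB : UB X Φ) :
    ∃ Q ≥ 0, ∃ C > 0, TameFlow X Φ Q C := by
  obtain ⟨-, ⟨Q, hQ⟩, g, hg, hg0, hT⟩ := hUB
  have hQ0 : 0 ≤ Q := (norm_nonneg _).trans (hQ 0)
  have hg1 : 0 ≤ g 1 := by
    by_cases hE : ∃ e : Euc n, ‖e‖ = 1
    · obtain ⟨e, he⟩ := hE
      have := (norm_nonneg _).trans (hT 0 0 0 e (by simp) he.le)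
      simpa [he] using this
    · have := (norm_nonneg _).trans (hT 0 0 1 0 (by simp) (by simp))
      simpa using this
  have hsmall : ∀ δ > (0 : ℝ), ∃ r > (0 : ℝ), ∀ h ∈ Ioc 0 r, g h ≤ δ * h := by
    intro δ hδ
    have h1 : ∀ᶠ h in nhdsWithin (0 : ℝ) (Ioi 0), g h / h < δ := hg0.eventually (gt_mem_nhds hδ)
    obtain ⟨r, hr, hr'⟩ := mem_nhdsGT_iff_exists_Ioc_subset.1 h1
    exact ⟨r, hr, fun h hh => ((div_lt_iff₀ hh.1).1 (hr' hh)).le⟩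
  have htaylor : ∀ δ > (0 : ℝ), ∃ r > (0 : ℝ), ∀ (t : ℝ) (x : Euc n) (h₁ : ℝ) (h₂ : Euc n),
      |h₁| + ‖h₂‖ ≤ r →
      ‖Φ (t + h₁) (x + h₂) - Φ t x - h₁ • X (Φ t x) - fderiv ℝ (Φ t) x h₂‖
        ≤ δ * (|h₁| + ‖h₂‖) := by
    intro δ hδ
    obtain ⟨r, hr, hr'⟩ := hsmall δ hδ
    refine ⟨min r 1, by positivity, fun t x h₁ h₂ h => ?_⟩
    have hr1 := h.trans (min_le_left _ _)
    have hr2 := h.trans (min_le_right _ _)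
    have := norm_nonneg h₂
    have := abs_nonneg h₁
    rcases eq_or_lt_of_le (by positivity : 0 ≤ |h₁| + ‖h₂‖) with h0 | h0
    · have e1 : h₁ = 0 := abs_eq_zero.1 (by linarith)
      have e2 : h₂ = 0 := norm_eq_zero.1 (by linarith)
      simp [e1, e2]
    · exact (hT x t h₁ h₂ (by linarith) (by linarith)).trans (hr' _ ⟨h0, hr1⟩)
  refine ⟨Q, hQ0, 1 + 2 * Q + g 1, by positivity, ?_⟩
  refine
    { map_zero := hΦ.1
      map_add := hΦ.map_add hX hQ
      hasDerivAt := hΦ.2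
      norm_sub_le := hΦ.norm_sub_le hQ
      taylor := htaylor
      hasFDerivAt := fun t x => ?_
      norm_fderiv_le := fun t x => ?_
      norm_fderiv_sub_le := fun δ hδ => ?_ }
  · rw [hasFDerivAt_iff_isLittleO_nhds_zero, Asymptotics.isLittleO_iff]
    intro δ hδ
    obtain ⟨r, hr, hr'⟩ := htaylor δ hδ
    filter_upwards [Metric.closedBall_mem_nhds (0 : Euc n) hr] with h hh
    simpa using hr' t x 0 h (by simpa using hh)
  · refine ContinuousLinearMap.opNorm_le_of_unit_norm (by positivity) fun h hh => ?_
    have h1 := hT x t 0 h (by simp) hh.le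
    simp only [add_zero, zero_smul, sub_zero, abs_zero, zero_add, hh] at h1
    have h2 := hΦ.norm_sub_le hQ t 0 x
    have h3 := hΦ.norm_sub_le hQ t 0 (x + h)
    rw [hΦ.1, sub_zero] at h2 h3
    have h4 : fderiv ℝ (Φ t) x h = (Φ t (x + h) - (x + h)) - (Φ t x - x) + h
      - (Φ t (x + h) - Φ t x - fderiv ℝ (Φ t) x h) := by abel
    have h5 : ‖fderiv ℝ (Φ t) x h‖ ≤ Q * |t| + Q * |t| + 1 + g 1 := by
      rw [h4]
      refine (norm_sub_le _ _).trans (add_le_add ((norm_add_le _ _).trans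
        (add_le_add ((norm_sub_le _ _).trans (add_le_add h3 h2)) hh.le)) h1)
    have := mul_nonneg hg1 (abs_nonneg t)
    nlinarith [abs_nonneg t]
  · obtain ⟨r, hr, hr'⟩ := htaylor (δ / 4) (by positivity)
    refine ⟨r / 2, by positivity, fun t x y hxy => ?_⟩
    refine ContinuousLinearMap.opNorm_le_of_unit_norm hδ.le fun e he => ?_
    set k : Euc n := (r / 2) • e
    have hk : ‖k‖ = r / 2 := by
      rw [norm_smul, he, Real.norm_of_nonneg (by positivity), mul_one]
    have hyxk : ‖y - x + k‖ ≤ r := (norm_add_le _ _).trans (by linarith)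
    have b1 := hr' t x 0 (y - x + k) (by simpa using hyxk)
    have b2 := hr' t x 0 (y - x) (by rw [abs_zero]; linarith)
    have b3 := hr' t y 0 k (by rw [abs_zero]; linarith)
    simp only [add_zero, zero_smul, sub_zero, abs_zero, zero_add, _root_.map_add] at b1 b2 b3
    rw [← add_assoc, add_sub_cancel] at b1
    rw [add_sub_cancel] at b2
    set D := fderiv ℝ (Φ t) y
    set D' := fderiv ℝ (Φ t) x
    have e1 : (D - D') k = (Φ t (y + k) - Φ t x - (D' (y - x) + D' k))
        - (Φ t y - Φ t x - D' (y - x)) - (Φ t (y + k) - Φ t y - D k) := by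
      rw [sub_apply]; abel
    have e2 : ‖(D - D') k‖ ≤ δ / 4 * r + δ / 4 * (r / 2) + δ / 4 * (r / 2) := by
      rw [e1]
      refine (norm_sub_le _ _).trans (add_le_add ((norm_sub_le _ _).trans
        (add_le_add (b1.trans ?_) (b2.trans ?_))) (b3.trans_eq (by rw [hk])))
      · gcongr
      · gcongr
    have e3 : ‖(D - D') k‖ = r / 2 * ‖(D - D') e‖ := by
      rw [map_smul, norm_smul, Real.norm_of_nonneg (by positivity)]
    rw [e3] at e2
    refine le_of_mul_le_mul_left (e2.trans_eq ?_) (by positivity : (0 : ℝ) < r / 2)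
    ring

namespace TameFlow

variable {n : ℕ} {X : Euc n → Euc n} {Φ : ℝ → Euc n → Euc n} {Q C : ℝ}

lemma fderiv_apply_fderiv (h : TameFlow X Φ Q C) (t s : ℝ) (x v : Euc n) :
    fderiv ℝ (Φ t) (Φ s x) (fderiv ℝ (Φ s) x v) = fderiv ℝ (Φ (t + s)) x v := by
  have h1 := (h.hasFDerivAt t (Φ s x)).comp x (h.hasFDerivAt s x)
  have h2 : Φ t ∘ Φ s = Φ (t + s) := funext fun y => (h.map_add t s y).symm
  rw [h2] at h1
  exact congrArg (fun A => A v) (h1.unique (h.hasFDerivAt (t + s) x))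

lemma fderiv_zero (h : TameFlow X Φ Q C) (x v : Euc n) : fderiv ℝ (Φ 0) x v = v := by
  have : Φ 0 = id := funext h.map_zero
  rw [this, fderiv_id]
  rfl

lemma fderiv_neg_apply_fderiv (h : TameFlow X Φ Q C) (t : ℝ) (x v : Euc n) :
    fderiv ℝ (Φ (-t)) (Φ t x) (fderiv ℝ (Φ t) x v) = v := by
  rw [h.fderiv_apply_fderiv, neg_add_cancel, h.fderiv_zero]

lemma fderiv_apply_fderiv_neg (h : TameFlow X Φ Q C) (t : ℝ) (x v : Euc n) :
    fderiv ℝ (Φ t) x (fderiv ℝ (Φ (-t)) (Φ t x) v) = v := by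
  have h1 := h.fderiv_apply_fderiv t (-t) (Φ t x) v
  rwa [← h.map_add, neg_add_cancel, h.map_zero, add_neg_cancel, h.fderiv_zero] at h1

/-- The vector field is invariant under its flow. -/
lemma fderiv_apply_vectorField (h : TameFlow X Φ Q C) (t : ℝ) (x : Euc n) :
    fderiv ℝ (Φ t) x (X x) = X (Φ t x) := by
  have h1 : HasDerivAt (fun s => Φ s x) (X x) 0 := by
    simpa only [h.map_zero] using h.hasDerivAt 0 x
  have h2 : HasDerivAt (fun s => Φ t (Φ s x)) (fderiv ℝ (Φ t) x (X x)) 0 := by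
    refine HasFDerivAt.comp_hasDerivAt (0 : ℝ) ?_ h1
    simpa only [h.map_zero] using h.hasFDerivAt t (Φ 0 x)
  have h3 : HasDerivAt (fun s => Φ t (Φ s x)) (X (Φ t x)) 0 := by
    have := (h.hasDerivAt (0 + t) x).comp_add_const 0 t
    simpa only [add_comm _ t, h.map_add, h.map_zero] using this
  exact h2.unique h3

lemma continuous_uncurry (h : TameFlow X Φ Q C) : Continuous fun q : ℝ × Euc n => Φ q.1 q.2 := by
  refine continuous_prod_of_continuous_lipschitzWith _ Q.toNNReal (fun t => ?_) fun x => ?_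
  · exact continuous_iff_continuousAt.2 fun x => (h.hasFDerivAt t x).continuousAt
  · refine LipschitzWith.of_dist_le_mul fun t s => ?_
    rw [dist_eq_norm, Real.dist_eq]
    exact (h.norm_sub_le t s x).trans
      (mul_le_mul_of_nonneg_right (Real.le_coe_toNNReal Q) (abs_nonneg _))

lemma norm_map_sub_map_le (h : TameFlow X Φ Q C) (t : ℝ) (x y : Euc n) :
    ‖Φ t x - Φ t y‖ ≤ C * (1 + |t|) * ‖x - y‖ :=
  convex_univ.norm_image_sub_le_of_norm_hasFDerivWithin_le
    (fun z _ => (h.hasFDerivAt t z).hasFDerivWithinAt) (fun z _ => h.norm_fderiv_le t z)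
    (mem_univ y) (mem_univ x)

end TameFlow

/-- A continuous family of maps which is the identity at time `0` can be uniformly approximated by
a smooth family which is the identity at time `0`. -/
lemma exists_contDiff_approx_of_eq_id {E : Type*} [NormedAddCommGroup E] [NormedSpace ℝ E]
    [FiniteDimensional ℝ E] {f : ℝ × E → E} (hf : Continuous f) (h0 : ∀ x, f (0, x) = x)
    {ε : ℝ} (hε : 0 < ε) :
    ∃ g : ℝ × E → E, ContDiff ℝ (⊤ : ℕ∞) g ∧ (∀ x, g (0, x) = x) ∧ ∀ q, ‖g q - f q‖ < ε := by
  set S : ℝ × E → Set E := fun q => Metric.ball (f q) ε ∩ {y | q.1 = 0 → y = q.2}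
  have hconv : ∀ q, Convex ℝ (S q) := by
    intro q
    refine (convex_ball _ _).inter ?_
    intro a ha b hb s t _ _ hst hq
    rw [ha hq, hb hq, ← add_smul, hst, one_smul]
  have hloc : ∀ q, ∃ U ∈ nhds q, ∃ g : ℝ × E → E,
      ContDiffOn ℝ (⊤ : ℕ∞) g U ∧ ∀ y ∈ U, g y ∈ S y := by
    rintro ⟨t, x⟩
    by_cases ht : t = 0
    · subst ht
      refine ⟨{q | ‖q.2 - f q‖ < ε}, ?_, Prod.snd, contDiff_snd.contDiffOn,
        fun q hq => ⟨mem_ball_iff_norm.2 hq, fun _ => rfl⟩⟩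
      refine (isOpen_lt (by fun_prop) continuous_const).mem_nhds ?_
      simpa [h0] using hε
    · refine ⟨{q | ‖f (t, x) - f q‖ < ε} ∩ {q | q.1 ≠ 0}, ?_, fun _ => f (t, x),
        contDiffOn_const, fun q hq => ⟨mem_ball_iff_norm.2 hq.1, fun h => absurd h hq.2⟩⟩
      refine ((isOpen_lt (by fun_prop) continuous_const).inter
        (isOpen_ne_fun continuous_fst continuous_const)).mem_nhds ⟨?_, ht⟩
      simpa using hε
  obtain ⟨g, hg⟩ := exists_contMDiffMap_forall_mem_convex_of_local (n := (⊤ : ℕ∞))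
    (modelWithCornersSelf ℝ (ℝ × E)) hconv fun q =>
      let ⟨U, hU, g, hgU, hgS⟩ := hloc q
      ⟨U, hU, g, hgU.contMDiffOn, hgS⟩
  exact ⟨g, g.contMDiff.contDiff, fun x => (hg (0, x)).2 rfl,
    fun q => mem_ball_iff_norm.1 (hg q).1⟩

/-- Moving the initial point near `p` along a slow curve `u` yields a smooth method. -/
lemma TameFlow.exists_smoothMethod {n : ℕ} {X : Euc n → Euc n} {Φ : ℝ → Euc n → Euc n} {Q C : ℝ}
    (h : TameFlow X Φ Q C) (hC : 0 < C) (p : Euc n) {u : ℝ → Euc n} {r ω d : ℝ}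
    (hr : 0 < r) (hd : 0 < d) (hu : Continuous u) (hu0 : u 0 = 0) (hur : ∀ t, ‖u t‖ ≤ r)
    (hω : ∀ t y, ‖y - p‖ ≤ 3 * r → ‖fderiv ℝ (Φ t) y - fderiv ℝ (Φ t) p‖ ≤ ω)
    (hslow : ∀ t, ∀ s ∈ Icc (-1 : ℝ) 1,
      ‖fderiv ℝ (Φ (t + s)) p (u (t + s) - u t)‖ + ω * ‖u (t + s) - u t‖ ≤ d / 2) :
    ∃ Ψ : ℝ → Euc n → Euc n, SmoothMethod Ψ ∧ IsMethod Φ Ψ d ∧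
      ∀ t x, ‖x - p‖ ≤ r → ‖Ψ t x - Φ t (x + u t)‖ ≤ d := by
  set χ : Euc n → ℝ := fun x => max 0 (min 1 (2 - ‖x - p‖ / r)) with hχ
  have hχ0 : ∀ x, 0 ≤ χ x := fun x => le_max_left _ _
  have hχ1 : ∀ x, χ x ≤ 1 := fun x => max_le zero_le_one (min_le_left _ _)
  have hχc : Continuous χ := by fun_prop
  set f : ℝ × Euc n → Euc n := fun q => Φ q.1 (q.2 + χ q.2 • u q.1)
  have hf : Continuous f := by
    have : Continuous fun q : ℝ × Euc n => (q.1, q.2 + χ q.2 • u q.1) := by fun_prop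
    exact h.continuous_uncurry.comp this
  have hf0 : ∀ x, f (0, x) = x := fun x => by simp [f, hu0, h.map_zero]
  have hfm : ∀ t, ∀ s ∈ Icc (-1 : ℝ) 1, ∀ x, ‖f (t + s, x) - Φ s (f (t, x))‖ ≤ d / 2 := by
    intro t s hs x
    have e1 : Φ s (f (t, x)) = Φ (t + s) (x + χ x • u t) := by
      rw [add_comm t s, h.map_add]
    rw [e1]
    change ‖Φ (t + s) (x + χ x • u (t + s)) - _‖ ≤ _
    by_cases hx : ‖x - p‖ ≤ 2 * r
    · have hmem : ∀ τ, x + χ x • u τ ∈ Metric.closedBall p (3 * r) := by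
        intro τ
        rw [mem_closedBall_iff_norm, add_sub_right_comm]
        refine (norm_add_le _ _).trans ?_
        have : ‖χ x • u τ‖ ≤ 1 * r := by
          rw [norm_smul, Real.norm_of_nonneg (hχ0 x)]
          exact mul_le_mul (hχ1 x) (hur τ) (norm_nonneg _) zero_le_one
        linarith
      have e2 := (convex_closedBall p (3 * r)).norm_image_sub_le_of_norm_hasFDerivWithin_le'
        (fun y _ => (h.hasFDerivAt (t + s) y).hasFDerivWithinAt)
        (fun y hy => hω (t + s) y (mem_closedBall_iff_norm.1 hy)) (hmem t) (hmem (t + s))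
      have e3 : x + χ x • u (t + s) - (x + χ x • u t) = χ x • (u (t + s) - u t) := by
        rw [add_sub_add_left_eq_sub, smul_sub]
      rw [e3, map_smul, norm_smul, Real.norm_of_nonneg (hχ0 x)] at e2
      have e4 := norm_le_norm_add_norm_sub' (Φ (t + s) (x + χ x • u (t + s)) -
        Φ (t + s) (x + χ x • u t)) (χ x • fderiv ℝ (Φ (t + s)) p (u (t + s) - u t))
      rw [norm_smul, Real.norm_of_nonneg (hχ0 x)] at e4
      calc _ ≤ χ x * (‖fderiv ℝ (Φ (t + s)) p (u (t + s) - u t)‖ + ω * ‖u (t + s) - u t‖) := by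
            linarith
        _ ≤ 1 * (d / 2) :=
            (mul_le_mul_of_nonneg_left (hslow t s hs) (hχ0 x)).trans
              (mul_le_mul_of_nonneg_right (hχ1 x) (by positivity))
        _ = d / 2 := one_mul _
    · have : χ x = 0 := by
        refine max_eq_left ((min_le_right _ _).trans ?_)
        rw [sub_nonpos, le_div_iff₀ hr]
        exact (not_le.1 hx).le
      rw [this, zero_smul, zero_smul, sub_self, norm_zero]
      positivity
  obtain ⟨g, hg, hg0, hgf⟩ := exists_contDiff_approx_of_eq_id hf hf0
    (ε := d / (2 * (1 + 2 * C))) (by positivity)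
  have hε : d / (2 * (1 + 2 * C)) * (1 + 2 * C) = d / 2 := by field_simp
  refine ⟨fun t x => g (t, x), hg, ⟨hg0, fun t s hs x => ?_⟩, fun t x hx => ?_⟩
  · have h1 : ‖Φ s (f (t, x)) - Φ s (g (t, x))‖ ≤ 2 * C * (d / (2 * (1 + 2 * C))) := by
      refine (h.norm_map_sub_map_le s _ _).trans ?_
      rw [norm_sub_rev]
      have : |s| ≤ 1 := abs_le.2 hs
      exact mul_le_mul (by nlinarith) (hgf _).le (norm_nonneg _) (by positivity)
    have h2 : g (t + s, x) - Φ s (g (t, x)) = (g (t + s, x) - f (t + s, x)) +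
      (f (t + s, x) - Φ s (f (t, x))) + (Φ s (f (t, x)) - Φ s (g (t, x))) := by abel
    change ‖g (t + s, x) - Φ s (g (t, x))‖ < d
    rw [h2]
    have h3 := norm_add₃_le (a := g (t + s, x) - f (t + s, x))
      (b := f (t + s, x) - Φ s (f (t, x))) (c := Φ s (f (t, x)) - Φ s (g (t, x)))
    linarith [hgf (t + s, x), hfm t s hs x]
  · have h1 : χ x = 1 := by
      have : 1 ≤ 2 - ‖x - p‖ / r := by
        have := (div_le_one hr).2 hx
        linarith
      simp only [hχ, min_eq_left this, max_eq_right zero_le_one]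
    have h2 := hgf (t, x)
    simp only [f, h1, one_smul] at h2
    refine h2.le.trans ((div_le_self hd.le ?_))
    linarith

/-- The ramp which rises from `0` to `1` on the interval `[k, k + 1]`. -/
def unitRamp (k t : ℝ) : ℝ := max 0 (min 1 (t - k))

lemma unitRamp_mono (k : ℝ) : Monotone (unitRamp k) := fun _ _ h =>
  max_le_max le_rfl (min_le_min le_rfl (sub_le_sub_right h k))

lemma unitRamp_nonneg (k t : ℝ) : 0 ≤ unitRamp k t := le_max_left _ _

lemma unitRamp_le_one (k t : ℝ) : unitRamp k t ≤ 1 := max_le zero_le_one (min_le_left _ _)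

lemma continuous_unitRamp (k : ℝ) : Continuous (unitRamp k) := by
  unfold unitRamp
  fun_prop

lemma sum_unitRamp (N : ℕ) (t : ℝ) :
    ∑ k ∈ Finset.range N, unitRamp k t = max 0 (min (N : ℝ) t) := by
  induction N with
  | zero => simp
  | succ N ih =>
    rw [Finset.sum_range_succ, ih, unitRamp]
    have : (0 : ℝ) ≤ N := N.cast_nonneg
    push_cast
    grind

lemma sum_abs_unitRamp_sub_le (N : ℕ) (s t : ℝ) :
    ∑ k ∈ Finset.range N, |unitRamp k s - unitRamp k t| ≤ |s - t| := by
  wlog h : t ≤ s generalizing s t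
  · simpa only [abs_sub_comm] using this t s (le_of_not_ge h)
  · rw [Finset.sum_congr rfl fun (k : ℕ) _ =>
      abs_of_nonneg (sub_nonneg.2 (unitRamp_mono (k : ℝ) h)), Finset.sum_sub_distrib,
      sum_unitRamp, sum_unitRamp]
    refine (le_abs_self _).trans ((abs_max_sub_max_le_max _ _ _ _).trans (max_le ?_ ?_))
    · simp
    · refine (abs_min_sub_min_le_max _ _ _ _).trans (max_le ?_ le_rfl)
      simp

lemma unitRamp_eq_of_two_lt {k s t : ℝ} (hst : |s - t| ≤ 1) (hk : 2 < |s - k|) :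
    unitRamp k s = unitRamp k t := by
  unfold unitRamp
  rw [abs_le] at hst
  rcases lt_abs.1 hk with hk | hk
  · rw [min_eq_left (by linarith), min_eq_left (by linarith)]
  · rw [max_eq_left ((min_le_right _ _).trans (by linarith)),
      max_eq_left ((min_le_right _ _).trans (by linarith))]

/-- A positive sequence decaying at most harmonically and growing at most linearly is not bounded
below by a multiple of its partial sums. -/
lemma false_of_sum_le_of_linear_growth {a : ℕ → ℝ} {c B K : ℝ} (hc : 0 < c) (hK : 0 < K)
    (hlow : ∀ k : ℕ, c / (1 + k) ≤ a k) (hup : ∀ k : ℕ, a k ≤ B * (1 + k))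
    (hsum : ∀ N, ∑ k ∈ Finset.range N, a k ≤ K * (1 + a N)) : False := by
  set S : ℕ → ℝ := fun N => ∑ k ∈ Finset.range N, a k
  have hS : Filter.Tendsto S Filter.atTop Filter.atTop := by
    refine Filter.tendsto_atTop_mono (fun N => ?_)
      (Real.tendsto_sum_range_one_div_nat_succ_atTop.const_mul_atTop hc)
    rw [Finset.mul_sum]
    refine Finset.sum_le_sum fun k _ => (le_of_eq ?_).trans (hlow k)
    rw [add_comm, mul_one_div]
  obtain ⟨M, hM⟩ := Filter.eventually_atTop.1 (hS.eventually_ge_atTop (2 * K))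
  set q := 1 + 1 / (2 * K)
  have hq : 1 < q := by
    have : 0 < 1 / (2 * K) := by positivity
    linarith
  have hstep : ∀ N ≥ M, q * S N ≤ S (N + 1) := by
    intro N hN
    have h1 : S (N + 1) = S N + a N := Finset.sum_range_succ _ _
    have h2 : S N ≤ 2 * K * a N := by
      have h3 : S N ≤ K * (1 + a N) := hsum N
      linarith [hM N hN]
    have h3 : 1 / (2 * K) * S N ≤ a N := by
      rw [one_div, inv_mul_le_iff₀ (by positivity)]
      exact h2
    rw [h1, add_mul]
    linarith
  have hpow : ∀ j, 2 * K * q ^ j ≤ S (M + j) := by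
    intro j
    induction j with
    | zero => simpa using hM M le_rfl
    | succ j ih =>
      have := hstep (M + j) (by lia)
      have h2 : q * (2 * K * q ^ j) ≤ q * S (M + j) :=
        mul_le_mul_of_nonneg_left ih (by linarith)
      calc _ = q * (2 * K * q ^ j) := by ring
        _ ≤ _ := h2.trans this
  have hB0 : 0 ≤ B := by
    have h1 := (hlow 0).trans (hup 0)
    simp at h1
    linarith
  have hB : ∀ N : ℕ, S N ≤ B * (1 + N) ^ 2 := by
    intro N
    calc S N ≤ ∑ k ∈ Finset.range N, B * (1 + N) := by
          refine Finset.sum_le_sum fun k hk => (hup k).trans ?_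
          have : (k : ℝ) ≤ N := by exact_mod_cast (Finset.mem_range.1 hk).le
          gcongr
      _ = B * (N * (1 + N)) := by rw [Finset.sum_const, Finset.card_range, nsmul_eq_mul]; ring
      _ ≤ B * (1 + N) ^ 2 := by
          refine mul_le_mul_of_nonneg_left ?_ hB0
          have : (0 : ℝ) ≤ N := N.cast_nonneg
          nlinarith
  have hlim : Filter.Tendsto (fun j : ℕ => B * ((1 + M : ℝ) ^ 2 * ((j + 1 : ℕ) : ℝ) ^ 2
      / q ^ (j + 1) * q)) Filter.atTop (nhds 0) := by
    have h1 := (Filter.tendsto_add_atTop_iff_nat 1).2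
      (tendsto_pow_const_div_const_pow_of_one_lt 2 hq)
    have h2 := ((h1.const_mul ((1 + M : ℝ) ^ 2)).mul_const q).const_mul B
    simpa only [mul_zero, zero_mul, mul_div_assoc] using h2
  obtain ⟨j, hj⟩ := (hlim.eventually (gt_mem_nhds (by positivity : 0 < 2 * K))).exists
  have h1 := (hpow j).trans (hB (M + j))
  have h2 : (1 + ((M + j : ℕ) : ℝ)) ^ 2 ≤ (1 + M : ℝ) ^ 2 * ((j + 1 : ℕ) : ℝ) ^ 2 := by
    rw [← mul_pow]
    have : (0 : ℝ) ≤ M * j := by positivity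
    refine pow_le_pow_left₀ (by positivity) ?_ 2
    push_cast
    linarith
  have hqj : 0 < q ^ j := by positivity
  have h3 : B * ((1 + M : ℝ) ^ 2 * ((j + 1 : ℕ) : ℝ) ^ 2 / q ^ (j + 1) * q) =
      B * ((1 + M : ℝ) ^ 2 * ((j + 1 : ℕ) : ℝ) ^ 2) / q ^ j := by
    rw [pow_succ q j]
    field_simp
  rw [h3, div_lt_iff₀ hqj] at hj
  exact absurd (h1.trans (mul_le_mul_of_nonneg_left h2 hB0)) (not_le.2 hj)

/-- Inverse shadowing of the point `p` bounds the total displacement, in a direction conormal to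
the orbit of `p`, which can be produced by unit kicks at the times `0, …, N - 1`. -/
lemma TameFlow.sum_apply_le {n : ℕ} {X : Euc n → Euc n} {Φ : ℝ → Euc n → Euc n} {Q C : ℝ}
    (h : TameFlow X Φ Q C) (hC : 0 < C) {p : Euc n} {L d₀ : ℝ} (hL : 0 < L) (hd₀ : 0 < d₀)
    (hshadow : ∀ d : ℝ, 0 < d → d ≤ d₀ → ∀ Ψ : ℝ → Euc n → Euc n, SmoothMethod Ψ →
      IsMethod Φ Ψ d → ∃ (phat : Euc n) (α : ℝ → ℝ), MemRep α (L * d) ∧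
        ∀ t : ℝ, ‖Φ t p - Ψ (α t) phat‖ < L * d)
    {w : Euc n →L[ℝ] ℝ} (hw : w (X p) = 0) {v : ℕ → Euc n}
    (hv : ∀ k : ℕ, ‖fderiv ℝ (Φ k) p (v k)‖ ≤ 1) (hwv : ∀ k, 0 ≤ w (v k)) (N : ℕ) :
    ∑ k ∈ Finset.range N, w (v k) ≤
      24 * C * (‖w‖ * L + ‖w.comp (fderiv ℝ (Φ (-N)) (Φ N p))‖ * (L + 2)) := by
  set U : ℝ → Euc n := fun t => ∑ k ∈ Finset.range N, unitRamp k t • v k with hU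
  set M : ℝ := ∑ k ∈ Finset.range N, ‖v k‖
  have hM0 : 0 ≤ M := Finset.sum_nonneg fun _ _ => norm_nonneg _
  set η : ℝ := 1 / (12 * C) with hη
  have hη0 : 0 < η := by positivity
  have hUc : Continuous U := continuous_finsetSum _ fun k _ =>
    (continuous_unitRamp k).smul continuous_const
  have hU0 : U 0 = 0 := by
    refine Finset.sum_eq_zero fun k _ => ?_
    have : (0 : ℝ) ≤ k := k.cast_nonneg
    rw [unitRamp, max_eq_left ((min_le_right _ _).trans (by linarith)), zero_smul]
  have hUM : ∀ t, ‖U t‖ ≤ M := fun t => norm_sum_le_of_le _ fun k _ => by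
    rw [norm_smul, Real.norm_of_nonneg (unitRamp_nonneg _ _)]
    exact mul_le_of_le_one_left (norm_nonneg _) (unitRamp_le_one _ _)
  have hUsub : ∀ s t, U s - U t = ∑ k ∈ Finset.range N, (unitRamp k s - unitRamp k t) • v k := by
    intro s t
    simp only [hU, ← Finset.sum_sub_distrib, sub_smul]
  have hUdiff : ∀ s t, |s - t| ≤ 1 → ‖U s - U t‖ ≤ M := by
    intro s t hst
    rw [hUsub]
    refine norm_sum_le_of_le _ fun k hk => ?_
    rw [norm_smul, Real.norm_eq_abs]
    refine mul_le_of_le_one_left (norm_nonneg _) ?_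
    exact (Finset.single_le_sum (f := fun k : ℕ => |unitRamp k s - unitRamp k t|)
      (fun _ _ => abs_nonneg _) hk).trans ((sum_abs_unitRamp_sub_le N s t).trans hst)
  have hDU : ∀ s t, |s - t| ≤ 1 → ‖fderiv ℝ (Φ s) p (U s - U t)‖ ≤ 3 * C := by
    intro s t hst
    rw [hUsub, map_sum]
    have hterm : ∀ k ∈ Finset.range N,
        ‖fderiv ℝ (Φ s) p ((unitRamp k s - unitRamp k t) • v k)‖ ≤
          |unitRamp k s - unitRamp k t| * (3 * C) := by
      intro k _
      rw [map_smul, norm_smul, Real.norm_eq_abs]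
      by_cases hk : 2 < |s - k|
      · rw [unitRamp_eq_of_two_lt hst hk]
        simp
      · refine mul_le_mul_of_nonneg_left ?_ (abs_nonneg _)
        have e1 := h.fderiv_apply_fderiv (s - k) k p (v k)
        rw [sub_add_cancel] at e1
        rw [← e1]
        refine ((fderiv ℝ (Φ (s - k)) (Φ k p)).le_opNorm _).trans ?_
        refine (mul_le_mul (h.norm_fderiv_le _ _) (hv k) (norm_nonneg _)
          (by positivity)).trans ?_
        rw [mul_one, mul_comm 3 C]
        exact mul_le_mul_of_nonneg_left (by linarith [not_lt.1 hk]) hC.le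
    refine (norm_sum_le_of_le _ hterm).trans ?_
    rw [← Finset.sum_mul]
    exact mul_le_of_le_one_left (by positivity) ((sum_abs_unitRamp_sub_le N s t).trans hst)
  set ω : ℝ := 1 / (4 * (η * M + 1)) with hω
  have hω0 : 0 < ω := by positivity
  obtain ⟨r₀, hr₀, hfd⟩ := h.norm_fderiv_sub_le ω hω0
  set r : ℝ := r₀ / 3 with hr
  have hrpos : 0 < r := by positivity
  set A : ℝ := L * N + L + η * M + 1 with hA
  have hηM : 0 ≤ η * M := by positivity
  have hLN : 0 ≤ L * N := by positivity
  have hA0 : 0 < A := by positivity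
  obtain ⟨ρ, hρ, htaylor⟩ := h.taylor (1 / A) (by positivity)
  set d : ℝ := min d₀ (min (r / A) (min (1 / 2 / A) (ρ / A)))
  have hdpos : 0 < d := by positivity
  have hdd₀ : d ≤ d₀ := min_le_left _ _
  have hdr : A * d ≤ r := by
    rw [← le_div_iff₀' hA0]
    exact (min_le_right _ _).trans (min_le_left _ _)
  have hd2 : A * d ≤ 1 / 2 := by
    rw [← le_div_iff₀' hA0]
    exact (min_le_right _ _).trans ((min_le_right _ _).trans (min_le_left _ _))
  have hdρ : A * d ≤ ρ := by
    rw [← le_div_iff₀' hA0]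
    exact (min_le_right _ _).trans ((min_le_right _ _).trans (min_le_right _ _))
  have hAd : A * d = L * N * d + L * d + η * M * d + d := by rw [hA]; ring
  have hp1 : 0 ≤ L * N * d := by positivity
  have hp2 : 0 ≤ L * d := by positivity
  have hp3 : 0 ≤ η * M * d := by positivity
  have hunorm : ∀ t, ‖(η * d) • U t‖ ≤ η * M * d := by
    intro t
    rw [norm_smul, Real.norm_of_nonneg (by positivity)]
    calc η * d * ‖U t‖ ≤ η * d * M := mul_le_mul_of_nonneg_left (hUM t) (by positivity)
      _ = η * M * d := by ring
  obtain ⟨Ψ, hΨ, hΨm, hΨΦ⟩ := h.exists_smoothMethod hC p (u := fun t => (η * d) • U t)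
    (r := r) (ω := ω) (d := d) hrpos hdpos (by fun_prop) (by simp [hU0])
    (fun t => (hunorm t).trans (by linarith))
    (fun t y hy => hfd t p y (hy.trans_eq (by rw [hr]; ring))) (by
      intro t s hs
      have hs' : |t + s - t| ≤ 1 := by rw [add_sub_cancel_left]; exact abs_le.2 hs
      rw [← smul_sub, map_smul, norm_smul, norm_smul, Real.norm_of_nonneg (by positivity)]
      have e1 : η * d * ‖fderiv ℝ (Φ (t + s)) p (U (t + s) - U t)‖ ≤ η * d * (3 * C) :=
        mul_le_mul_of_nonneg_left (hDU _ _ hs') (by positivity)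
      have e2 : η * d * (3 * C) = d / 4 := by rw [hη]; field_simp; norm_num
      have e3 : ω * (η * d * ‖U (t + s) - U t‖) ≤ ω * (η * d * M) := by
        have := hUdiff _ _ hs'
        gcongr
      have e4 : ω * (η * d * M) ≤ d / 4 := by
        have : ω * (η * M) ≤ 1 / 4 := by
          rw [hω, div_mul_eq_mul_div, one_mul, div_le_div_iff₀ (by positivity) (by positivity)]
          linarith
        nlinarith
      linarith)
  obtain ⟨q, α, hα, hq⟩ := hshadow d hdpos hdd₀ Ψ hΨ hΨm
  have hqp : ‖q - p‖ ≤ L * d := by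
    have := hq 0
    rw [hα.2.2.1, h.map_zero, hΨm.1, norm_sub_rev] at this
    exact this.le
  set τ : ℝ := α N - N with hτ
  have hτN : |τ| ≤ L * N * d := by
    rcases Nat.eq_zero_or_pos N with h0 | h0
    · have : τ = 0 := by rw [hτ, h0, Nat.cast_zero, hα.2.2.1, sub_zero]
      rw [this, abs_zero]
      exact hp1
    · have hN : (0 : ℝ) < N := by exact_mod_cast h0
      have := hα.2.2.2 N 0 hN.ne'
      rw [hα.2.2.1, sub_zero, sub_zero, div_sub_one hN.ne', abs_div, abs_of_pos hN,
        div_le_iff₀ hN] at this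
      calc |τ| ≤ L * d * N := this
        _ = L * N * d := by ring
  have hαN : α N = N + τ := by rw [hτ]; ring
  set y : Euc n := q - p + (η * d) • U (α N) with hy
  have hyn : ‖y‖ ≤ L * d + η * M * d := (norm_add_le _ _).trans (add_le_add hqp (hunorm _))
  have hT := htaylor N p τ y (by linarith)
  have hT' : ‖Φ (N + τ) (p + y) - Φ N p - τ • X (Φ N p) - fderiv ℝ (Φ N) p y‖ ≤ d := by
    refine hT.trans ?_
    rw [one_div, inv_mul_le_iff₀ hA0]
    linarith
  have hclose : ‖Φ N p - Φ (N + τ) (p + y)‖ ≤ L * d + d := by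
    have e1 := hΨΦ (α N) q (by linarith)
    have e2 : p + y = q + (η * d) • U (α N) := by rw [hy]; abel
    rw [e2, ← hαN, ← sub_add_sub_cancel _ (Ψ (α N) q)]
    exact (norm_add_le _ _).trans (add_le_add (hq N).le e1)
  have hlin : ‖τ • X (Φ N p) + fderiv ℝ (Φ N) p y‖ ≤ (L + 2) * d := by
    have e : τ • X (Φ N p) + fderiv ℝ (Φ N) p y = -((Φ N p - Φ (N + τ) (p + y)) +
      (Φ (N + τ) (p + y) - Φ N p - τ • X (Φ N p) - fderiv ℝ (Φ N) p y)) := by abel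
    rw [e, norm_neg]
    refine (norm_add_le _ _).trans ?_
    linarith
  set W := w.comp (fderiv ℝ (Φ (-N)) (Φ N p)) with hW
  have hWy : W (τ • X (Φ N p) + fderiv ℝ (Φ N) p y) = w y := by
    rw [_root_.map_add, map_smul, ← h.fderiv_apply_vectorField, hW,
      ContinuousLinearMap.comp_apply, ContinuousLinearMap.comp_apply,
      h.fderiv_neg_apply_fderiv, h.fderiv_neg_apply_fderiv, hw, smul_zero, zero_add]
  have hwy : w y ≤ ‖W‖ * ((L + 2) * d) := by
    rw [← hWy]
    exact (le_abs_self _).trans ((W.le_opNorm _).trans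
      (mul_le_mul_of_nonneg_left hlin (norm_nonneg _)))
  have hwq : -(‖w‖ * (L * d)) ≤ w (q - p) :=
    (abs_le.1 ((w.le_opNorm _).trans (mul_le_mul_of_nonneg_left hqp (norm_nonneg _)))).1
  have hwU : (∑ k ∈ Finset.range N, w (v k)) / 2 ≤ w (U (α N)) := by
    rw [hU, map_sum, Finset.sum_div]
    refine Finset.sum_le_sum fun k hk => ?_
    have hkN : (k : ℝ) + 1 ≤ N := by exact_mod_cast Finset.mem_range.1 hk
    have hramp : 1 / 2 ≤ unitRamp k (α N) := by
      refine le_max_of_le_right (le_min (by norm_num) ?_)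
      have := (abs_le.1 hτN).1
      linarith
    rw [map_smul, smul_eq_mul, div_eq_inv_mul, ← one_div]
    exact mul_le_mul_of_nonneg_right hramp (hwv k)
  rw [hy, _root_.map_add, map_smul, smul_eq_mul] at hwy
  have hfin : d * (η * w (U (α N))) ≤ d * (‖w‖ * L + ‖W‖ * (L + 2)) := by linarith
  have hfin' := le_of_mul_le_mul_left hfin hdpos
  have hfin'' : η * ((∑ k ∈ Finset.range N, w (v k)) / 2) ≤ ‖w‖ * L + ‖W‖ * (L + 2) :=
    (mul_le_mul_of_nonneg_left hwU hη0.le).trans hfin'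
  rw [hη, div_mul_eq_mul_div, one_mul, div_le_iff₀ (by positivity)] at hfin''
  linarith

/-- For a tame flow, inverse shadowing of a single point forces its velocity to span the space. -/
lemma TameFlow.span_eq_top {n : ℕ} {X : Euc n → Euc n} {Φ : ℝ → Euc n → Euc n} {Q C : ℝ}
    (h : TameFlow X Φ Q C) (hC : 0 < C) (hLISP : LISP Φ SmoothMethod) (p : Euc n) :
    Submodule.span ℝ {X p} = ⊤ := by
  by_contra hspan
  obtain ⟨f, hf0, hf⟩ := Submodule.exists_le_ker_of_lt_top _ (lt_top_iff_ne_top.2 hspan)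
  set w : Euc n →L[ℝ] ℝ := LinearMap.toContinuousLinearMap f
  have hw0 : 0 < ‖w‖ := by
    rw [norm_pos_iff]
    intro hw
    exact hf0 (LinearMap.ext fun x => congrArg (fun A => A x) hw)
  have hw : w (X p) = 0 := hf (Submodule.mem_span_singleton_self _)
  obtain ⟨L, hL, d₀, hd₀, hshadow⟩ := hLISP p
  set W : ℕ → Euc n →L[ℝ] ℝ := fun k => w.comp (fderiv ℝ (Φ (-k)) (Φ k p)) with hW
  have hWv : ∀ (k : ℕ) (v : Euc n), W k (fderiv ℝ (Φ k) p v) = w v := fun k v => by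
    rw [hW, ContinuousLinearMap.comp_apply, h.fderiv_neg_apply_fderiv]
  have hup : ∀ k : ℕ, ‖W k‖ ≤ ‖w‖ * C * (1 + k) := by
    intro k
    refine (w.opNorm_comp_le _).trans ?_
    rw [mul_assoc]
    refine mul_le_mul_of_nonneg_left ((h.norm_fderiv_le _ _).trans_eq ?_) hw0.le
    rw [abs_neg, Nat.abs_cast]
  have hlow : ∀ k : ℕ, ‖w‖ / C / (1 + k) ≤ ‖W k‖ := by
    intro k
    rw [div_div, div_le_iff₀ (by positivity)]
    refine w.opNorm_le_bound (by positivity) fun v => ?_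
    rw [← hWv k v, mul_assoc]
    refine ((W k).le_opNorm _).trans (mul_le_mul_of_nonneg_left ?_ (norm_nonneg _))
    refine ((fderiv ℝ (Φ k) p).le_opNorm v).trans
      (mul_le_mul_of_nonneg_right ((h.norm_fderiv_le _ _).trans_eq ?_) (norm_nonneg _))
    rw [Nat.abs_cast]
  have hb : ∀ k, ∃ b : Euc n, ‖b‖ ≤ 1 ∧ ‖W k‖ / 2 ≤ W k b := by
    intro k
    have hpos : 0 < ‖W k‖ := lt_of_lt_of_le (by positivity) (hlow k)
    obtain ⟨b, hb1, hb2⟩ := (W k).exists_lt_apply_of_lt_opNorm (half_lt_self hpos)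
    rcases abs_cases (W k b) with ⟨hb, -⟩ | ⟨hb, -⟩
    · exact ⟨b, hb1.le, by rw [← hb]; exact hb2.le⟩
    · exact ⟨-b, by rw [norm_neg]; exact hb1.le, by rw [map_neg, ← hb]; exact hb2.le⟩
  choose b hb1 hb2 using hb
  have hbv : ∀ k : ℕ, fderiv ℝ (Φ k) p (fderiv ℝ (Φ (-k)) (Φ k p) (b k)) = b k :=
    fun k => h.fderiv_apply_fderiv_neg k p (b k)
  refine false_of_sum_le_of_linear_growth (a := fun k => ‖W k‖)
    (K := 48 * C * (‖w‖ * L + (L + 2))) (by positivity) (by positivity) hlow hup fun N => ?_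
  have hsum := h.sum_apply_le hC hL hd₀ hshadow hw
    (v := fun k => fderiv ℝ (Φ (-k)) (Φ k p) (b k)) (fun k => by rw [hbv]; exact hb1 k)
    (fun k => (half_pos (lt_of_lt_of_le (by positivity) (hlow k))).le.trans (hb2 k)) N
  have hhalf : (∑ k ∈ Finset.range N, ‖W k‖) / 2 ≤
      ∑ k ∈ Finset.range N, w (fderiv ℝ (Φ (-k)) (Φ k p) (b k)) := by
    rw [Finset.sum_div]
    exact Finset.sum_le_sum fun k _ => hb2 k
  have hWN : 0 ≤ ‖W N‖ := norm_nonneg _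
  have hexp : ‖w‖ * L + ‖W N‖ * (L + 2) ≤ (‖w‖ * L + (L + 2)) * (1 + ‖W N‖) := by
    have : 0 ≤ ‖w‖ * L * ‖W N‖ := by positivity
    nlinarith
  have := mul_le_mul_of_nonneg_left hexp (by positivity : 0 ≤ 24 * C)
  have hsum' := hhalf.trans (hsum.trans this)
  linarith

/-- Statement 4.3 of the paper, for `M = ℝⁿ`: if the flow `Φ` of the `C¹`
vector field `X` satisfies condition (UB), has `inf |X| > 0`, and has Lipschitz inverse
shadowing with respect to the class of smooth methods, then there is a constant `L₁ > 0`
such that for every `p`, every sequence `z` with `|z_k| ≤ 1` and every `N`, the finite system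
`x_{k+1} = A_k x_k + s_k X(p_{k+1}) + z_{k+1}`, `k ∈ [-N, N-1]`, admits a solution bounded
by `L₁`, where `p_k = Φ(k, p)` and `A_k = D(Φ(1,·))(p_k)`. -/
theorem statement0 {n : ℕ} (X : Euc n → Euc n) (Φ : ℝ → Euc n → Euc n)
    (hX : ContDiff ℝ 1 X) (hflow : IsFlow X Φ) (hUB : UB X Φ)
    (hnonsing : ∃ c > (0 : ℝ), ∀ x : Euc n, c ≤ ‖X x‖)
    (hLISP : LISP Φ SmoothMethod) :
    ∃ L₁ > (0 : ℝ), ∀ (p : Euc n) (z : ℤ → Euc n), (∀ k : ℤ, ‖z k‖ ≤ 1) → ∀ N : ℕ,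
      ∃ (s : ℤ → ℝ) (x : ℤ → Euc n),
        (∀ k ∈ Icc (-(N : ℤ)) (N : ℤ), ‖x k‖ ≤ L₁) ∧
        ∀ k ∈ Icc (-(N : ℤ)) ((N : ℤ) - 1),
          x (k + 1) = fderiv ℝ (Φ 1) (Φ (k : ℝ) p) (x k)
            + s k • X (Φ ((k : ℝ) + 1) p) + z (k + 1) := by
  obtain ⟨Q, -, C, hC, hT⟩ := exists_tameFlow hX hflow hUB
  obtain ⟨c, hc, hcX⟩ := hnonsing
  have hX0 : ∀ x, X x ≠ 0 := fun x => norm_pos_iff.1 (hc.trans_le (hcX x))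
  have hdim : Module.finrank ℝ (Euc n) = 1 := by
    rw [← finrank_top, ← hT.span_eq_top hC hLISP 0, finrank_span_singleton (hX0 0)]
  refine ⟨1, one_pos, fun p z _ N => ?_⟩
  choose s hs using fun k : ℤ =>
    exists_smul_eq_of_finrank_eq_one hdim (hX0 (Φ ((k : ℝ) + 1) p)) (-z (k + 1))
  refine ⟨s, fun _ => 0, fun _ _ => by simp, fun k _ => ?_⟩
  rw [hs, map_zero, zero_add, neg_add_cancel]
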